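/- Let (𝒳, d) be a complete separable metric space, x₀ ∈ 𝒳, and let 1 ≤ q < r. Let μ_n (n ≥ 1) and μ be Borel probability measures on 𝒳 such that μ_n converges weakly to μ, ∫_𝒳 d(x, x₀)^r dμ(x) < ∞, and sup_{n≥1} ∫_𝒳 d(x, x₀)^r dμ_n(x) < ∞. Then 𝒲_q(μ_n, μ) → 0 as n → ∞. -/

import Mathlib

open MeasureTheory Filter
open scoped ENNReal

/-- The `q`-Wasserstein distance between Borel probability measures `μ, ν` on a metric
space, defined as the infimum over all couplings `π` (measures on `𝒳 × 𝒳` whose first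
marginal is `μ` and second marginal is `ν`) of `(∫ d(x,y)^q dπ)^{1/q}`. -/
noncomputable def wassersteinDist {𝒳 : Type*} [MetricSpace 𝒳] [MeasurableSpace 𝒳]
    (q : ℝ) (μ ν : Measure 𝒳) : ℝ≥0∞ :=
  ⨅ (π : Measure (𝒳 × 𝒳)) (_ : π.map Prod.fst = μ) (_ : π.map Prod.snd = ν),
    (∫⁻ p, ENNReal.ofReal (dist p.1 p.2 ^ q) ∂π) ^ (1/q)

namespace WC
open Set

variable {X : Type*} [MetricSpace X] [TopologicalSpace.SeparableSpace X]
  [MeasurableSpace X] [BorelSpace X]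

/-- Normalised product of two finite measures with equal mass. -/
noncomputable def pc {X : Type*} [MeasurableSpace X] (α β : Measure X) : Measure (X × X) :=
  (α univ)⁻¹ • α.prod β

theorem pc_fst {X : Type*} [MeasurableSpace X] (α β : Measure X) [IsFiniteMeasure α]
    [IsFiniteMeasure β] (h : α univ = β univ) : (pc α β).map Prod.fst = α := by
  rw [pc, Measure.map_smul, Measure.map_fst_prod, ← h, smul_smul]
  by_cases h0 : α univ = 0
  · have : α = 0 := Measure.measure_univ_eq_zero.1 h0
    simp [this]
  · rw [ENNReal.inv_mul_cancel h0 (measure_ne_top _ _), one_smul]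

theorem pc_snd {X : Type*} [MeasurableSpace X] (α β : Measure X) [IsFiniteMeasure α]
    [IsFiniteMeasure β] (h : α univ = β univ) : (pc α β).map Prod.snd = β := by
  rw [pc, Measure.map_smul, Measure.map_snd_prod, smul_smul]
  by_cases h0 : α univ = 0
  · have : β = 0 := Measure.measure_univ_eq_zero.1 (h ▸ h0)
    simp [this]
  · rw [ENNReal.inv_mul_cancel h0 (measure_ne_top _ _), one_smul]

theorem moment (x₀ : X) (q r : ℝ) (hq : 1 ≤ q) (hqr : q < r) (σ : Measure X) :
    ∫⁻ x, edist x x₀ ^ q ∂σ ≤ (∫⁻ x, edist x x₀ ^ r ∂σ) ^ (q / r) * σ univ ^ (1 - q / r) := by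
  have hq0 : 0 < q := by linarith
  have hr0 : 0 < r := by linarith
  have hm : AEStronglyMeasurable (fun x => edist x x₀) σ :=
    (continuous_id.edist continuous_const).aestronglyMeasurable
  have := eLpNorm'_le_eLpNorm'_mul_rpow_measure_univ hq0 hqr.le hm
  simp only [eLpNorm', enorm_eq_self] at this
  have h2 := ENNReal.rpow_le_rpow this hq0.le
  rw [ENNReal.mul_rpow_of_nonneg _ _ hq0.le, ← ENNReal.rpow_mul, ← ENNReal.rpow_mul,
    ← ENNReal.rpow_mul] at h2
  have e1 : 1 / q * q = 1 := by field_simp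
  have e2 : 1 / r * q = q / r := by field_simp
  have e3 : (1 / q - 1 / r) * q = 1 - q / r := by field_simp
  rwa [e1, e2, e3, ENNReal.rpow_one] at h2

theorem residual (x₀ : X) (q : ℝ) (hq : 1 ≤ q) (σ τ : Measure X) [IsFiniteMeasure σ]
    [IsFiniteMeasure τ] (h : σ univ = τ univ) :
    ∫⁻ p, edist p.1 p.2 ^ q ∂(pc σ τ) ≤
      2 ^ (q - 1) * (∫⁻ x, edist x x₀ ^ q ∂σ + ∫⁻ x, edist x x₀ ^ q ∂τ) := by
  have hm : Measurable (fun x : X => edist x x₀ ^ q) := by fun_prop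
  have e1 : ∫⁻ x, edist x x₀ ^ q ∂σ = ∫⁻ p, edist p.1 x₀ ^ q ∂(pc σ τ) := by
    conv_lhs => rw [← pc_fst σ τ h]
    rw [lintegral_map hm measurable_fst]
  have e2 : ∫⁻ x, edist x x₀ ^ q ∂τ = ∫⁻ p, edist p.2 x₀ ^ q ∂(pc σ τ) := by
    conv_lhs => rw [← pc_snd σ τ h]
    rw [lintegral_map hm measurable_snd]
  have hm1 : Measurable (fun p : X × X => edist p.1 x₀ ^ q) := hm.comp measurable_fst
  have hm2 : Measurable (fun p : X × X => edist p.2 x₀ ^ q) := hm.comp measurable_snd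
  have hm3 : Measurable (fun p : X × X => edist p.1 x₀ ^ q + edist p.2 x₀ ^ q) := hm1.add hm2
  rw [e1, e2, ← lintegral_add_left hm1, ← lintegral_const_mul _ hm3]
  refine lintegral_mono fun p => ?_
  refine le_trans (ENNReal.rpow_le_rpow (edist_triangle_right p.1 p.2 x₀) (by linarith)) ?_
  exact ENNReal.rpow_add_le_mul_rpow_add_rpow _ _ hq

theorem piece (q : ℝ) (hq : 1 ≤ q) (α β : Measure X) [IsFiniteMeasure α]
    [IsFiniteMeasure β] (h : α univ = β univ) (A : Set X) (hA : MeasurableSet A)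
    (hα : ∀ᵐ x ∂α, x ∈ A)
    (hβ : ∀ᵐ x ∂β, x ∈ A) (c : ℝ≥0∞) (hc : ∀ x ∈ A, ∀ y ∈ A, edist x y ≤ c) :
    ∫⁻ p, edist p.1 p.2 ^ q ∂(pc α β) ≤ c ^ q * α univ := by
  have h1 : ∀ᵐ p ∂(pc α β), p.1 ∈ A := by
    rw [← pc_fst α β h] at hα
    exact ae_of_ae_map measurable_fst.aemeasurable hα
  have h2 : ∀ᵐ p ∂(pc α β), p.2 ∈ A := by
    rw [← pc_snd α β h] at hβ
    exact ae_of_ae_map measurable_snd.aemeasurable hβ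
  have hu : (pc α β) univ = α univ := by
    conv_rhs => rw [← pc_fst α β h, Measure.map_apply measurable_fst MeasurableSet.univ]
    rfl
  calc _ ≤ ∫⁻ p, c ^ q ∂(pc α β) := by
        refine lintegral_mono_ae ?_
        filter_upwards [h1, h2] with p a b
        exact ENNReal.rpow_le_rpow (hc _ a _ b) (by linarith)
    _ = _ := by rw [lintegral_const, hu]

theorem scale_le (μ : Measure X) (A : ℕ → Set X) (hA : ∀ i, MeasurableSet (A i))
    (hd : Pairwise (Function.onFun Disjoint A)) (N : ℕ) (c : ℕ → ℝ≥0∞) (hc : ∀ i, c i ≤ 1) :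
    ∑ i ∈ Finset.range N, c i • μ.restrict (A i) ≤ μ := by
  calc _ ≤ ∑ i ∈ Finset.range N, μ.restrict (A i) := by
        refine Finset.sum_le_sum fun i _ => ?_
        rw [Measure.le_iff]
        intro s _
        simpa using mul_le_mul_left (hc i) (μ.restrict (A i) s)
    _ = μ.restrict (⋃ i ∈ Finset.range N, A i) := by
        rw [Measure.restrict_biUnion_finset (fun i _ j _ hij => hd hij) hA]
        rw [Measure.sum_fintype, Finset.sum_coe_sort (Finset.range N) (fun i => μ.restrict (A i))]
    _ ≤ μ := Measure.restrict_le_self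

theorem dcancel (a b : ℝ≥0∞) (h : a ≤ b) (hb : b ≠ ⊤) : a / b * b = a := by
  by_cases h0 : b = 0
  · subst h0; simp at h; simp [h]
  · exact ENNReal.div_mul_cancel h0 hb

theorem main_bound (x₀ : X) (q r : ℝ) (hq : 1 ≤ q) (hqr : q < r) (μ ν : Measure X)
    [IsProbabilityMeasure μ] [IsProbabilityMeasure ν] (A : ℕ → Set X)
    (hA : ∀ i, MeasurableSet (A i)) (hd : Pairwise (Function.onFun Disjoint A)) (N : ℕ)
    (c C ρ : ℝ≥0∞) (hc : ∀ i, ∀ x ∈ A i, ∀ y ∈ A i, edist x y ≤ c)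
    (hμ : ∫⁻ x, edist x x₀ ^ r ∂μ ≤ C) (hν : ∫⁻ x, edist x x₀ ^ r ∂ν ≤ C)
    (hρ : 1 ≤ ρ + ∑ i ∈ Finset.range N, min (μ (A i)) (ν (A i))) :
    wassersteinDist q μ ν ≤
      (c ^ q + 2 ^ (q - 1) * (2 * (C ^ (q / r) * ρ ^ (1 - q / r)))) ^ (1 / q) := by
  have hq0 : 0 < q := by linarith
  have hr0 : 0 < r := by linarith
  set m : ℕ → ℝ≥0∞ := fun i => min (μ (A i)) (ν (A i)) with hm
  have hmt : ∀ i, m i ≠ ⊤ := fun i => ((min_le_left _ _).trans_lt (measure_lt_top μ _)).ne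
  set α : ℕ → Measure X := fun i => (m i / μ (A i)) • μ.restrict (A i) with hα
  set β : ℕ → Measure X := fun i => (m i / ν (A i)) • ν.restrict (A i) with hβ
  have hαu : ∀ i, α i univ = m i := fun i => by
    simpa [hα] using dcancel (m i) (μ (A i)) (min_le_left _ _) (measure_ne_top _ _)
  have hβu : ∀ i, β i univ = m i := fun i => by
    simpa [hβ] using dcancel (m i) (ν (A i)) (min_le_right _ _) (measure_ne_top _ _)
  have hαf : ∀ i, IsFiniteMeasure (α i) := fun i => ⟨by rw [hαu]; exact (hmt i).lt_top⟩
  have hβf : ∀ i, IsFiniteMeasure (β i) := fun i => ⟨by rw [hβu]; exact (hmt i).lt_top⟩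
  have hαle : ∑ i ∈ Finset.range N, α i ≤ μ := scale_le μ A hA hd N _ fun i =>
    ENNReal.div_le_of_le_mul (by rw [one_mul]; exact min_le_left _ _)
  have hβle : ∑ i ∈ Finset.range N, β i ≤ ν := scale_le ν A hA hd N _ fun i =>
    ENNReal.div_le_of_le_mul (by rw [one_mul]; exact min_le_right _ _)
  set a := ∑ i ∈ Finset.range N, α i with ha
  set b := ∑ i ∈ Finset.range N, β i with hb
  have : IsFiniteMeasure a := ⟨(hαle univ).trans_lt (measure_lt_top μ _)⟩
  have : IsFiniteMeasure b := ⟨(hβle univ).trans_lt (measure_lt_top ν _)⟩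
  have hau : a univ = ∑ i ∈ Finset.range N, m i := by
    simp [ha, Measure.finsetSum_apply, hαu]
  have hbu : b univ = ∑ i ∈ Finset.range N, m i := by
    simp [hb, Measure.finsetSum_apply, hβu]
  have hsa : (μ - a) + a = μ := Measure.sub_add_cancel_of_le hαle
  have htb : (ν - b) + b = ν := Measure.sub_add_cancel_of_le hβle
  have hσle : μ - a ≤ μ := Measure.sub_le
  have hτle : ν - b ≤ ν := Measure.sub_le
  set σ := μ - a
  set τ := ν - b
  have : IsFiniteMeasure σ := ⟨(hσle univ).trans_lt (measure_lt_top μ _)⟩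
  have : IsFiniteMeasure τ := ⟨(hτle univ).trans_lt (measure_lt_top ν _)⟩
  have hSt : ∑ i ∈ Finset.range N, m i ≠ ⊤ := hau ▸ measure_ne_top a _
  have hσu : σ univ + ∑ i ∈ Finset.range N, m i = 1 := by
    rw [← hau, ← Measure.add_apply, hsa, measure_univ]
  have hτu : τ univ + ∑ i ∈ Finset.range N, m i = 1 := by
    rw [← hbu, ← Measure.add_apply, htb, measure_univ]
  have hst : σ univ = τ univ := (ENNReal.add_left_inj hSt).1 (hσu.trans hτu.symm)
  have hσρ : σ univ ≤ ρ := by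
    rw [← hσu] at hρ
    exact (ENNReal.add_le_add_iff_right hSt).1 hρ
  have hS1 : ∑ i ∈ Finset.range N, m i ≤ 1 := hσu ▸ le_add_self
  set P := pc σ τ + ∑ i ∈ Finset.range N, pc (α i) (β i) with hP
  have hP1 : P.map Prod.fst = μ := by
    rw [hP, Measure.map_add _ _ measurable_fst, Measure.map_finset_sum measurable_fst.aemeasurable,
      pc_fst σ τ hst, Finset.sum_congr rfl fun i _ => pc_fst (α i) (β i) (by rw [hαu, hβu]), ← ha,
      hsa]
  have hP2 : P.map Prod.snd = ν := by
    rw [hP, Measure.map_add _ _ measurable_snd, Measure.map_finset_sum measurable_snd.aemeasurable,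
      pc_snd σ τ hst, Finset.sum_congr rfl fun i _ => pc_snd (α i) (β i) (by rw [hαu, hβu]), ← hb,
      htb]
  have hmσ : ∀ (κ η : Measure X), κ ≤ η → κ univ ≤ ρ → ∫⁻ x, edist x x₀ ^ r ∂η ≤ C →
      ∫⁻ x, edist x x₀ ^ q ∂κ ≤ C ^ (q / r) * ρ ^ (1 - q / r) := by
    intro κ η h1 h2 h3
    refine (moment x₀ q r hq hqr κ).trans ?_
    have : 0 ≤ 1 - q / r := by
      rw [sub_nonneg, div_le_one hr0]; exact hqr.le
    exact mul_le_mul' (ENNReal.rpow_le_rpow ((lintegral_mono' h1 le_rfl).trans h3) (by positivity))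
      (ENNReal.rpow_le_rpow h2 this)
  have e : ∀ p : X × X, ENNReal.ofReal (dist p.1 p.2 ^ q) = edist p.1 p.2 ^ q := fun p => by
    rw [edist_dist, ENNReal.ofReal_rpow_of_nonneg dist_nonneg hq0.le]
  refine (iInf_le_of_le P (iInf_le_of_le hP1 (iInf_le_of_le hP2 le_rfl))).trans ?_
  refine ENNReal.rpow_le_rpow ?_ (by positivity)
  simp_rw [e]
  rw [hP, lintegral_add_measure, lintegral_finsetSum_measure, add_comm]
  refine add_le_add ?_ ?_
  · calc _ ≤ ∑ i ∈ Finset.range N, c ^ q * m i := by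
          refine Finset.sum_le_sum fun i _ => ?_
          rw [← hαu i]
          refine piece q hq (α i) (β i) (by rw [hαu, hβu]) (A i) (hA i) ?_ ?_ c (hc i)
          · exact Measure.ae_smul_measure (ae_restrict_mem (hA i)) _
          · exact Measure.ae_smul_measure (ae_restrict_mem (hA i)) _
      _ = c ^ q * ∑ i ∈ Finset.range N, m i := by rw [Finset.mul_sum]
      _ ≤ c ^ q := mul_le_of_le_one_right' hS1
  · refine (residual x₀ q hq σ τ hst).trans ?_
    rw [two_mul]
    gcongr
    · exact hmσ σ μ hσle hσρ hμ
    · exact hmσ τ ν hτle (hst ▸ hσρ) hν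

theorem partition (x₀ : X) (μ : Measure X) [IsProbabilityMeasure μ] (η : ℝ) (hη : 0 < η) :
    ∃ A : ℕ → Set X, (∀ i, MeasurableSet (A i)) ∧ Pairwise (Function.onFun Disjoint A) ∧
      (⋃ i, A i = univ) ∧ (∀ i, μ (frontier (A i)) = 0) ∧
      ∀ i, ∀ x ∈ A i, ∀ y ∈ A i, edist x y ≤ ENNReal.ofReal (2 * η) := by
  have : Nonempty X := ⟨x₀⟩
  choose ρ hρ hf using fun i : ℕ => exists_null_frontier_thickening μ
    {TopologicalSpace.denseSeq X i} (half_lt_self hη)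
  simp only [Metric.thickening_singleton] at hf
  set B : ℕ → Set X := fun i => Metric.ball (TopologicalSpace.denseSeq X i) (ρ i) with hB
  refine ⟨disjointed B, fun i => ?_, disjoint_disjointed B, ?_, fun i => ?_, ?_⟩
  · exact MeasurableSet.disjointed (fun i => Metric.isOpen_ball.measurableSet) i
  · rw [iUnion_disjointed, eq_univ_iff_forall]
    intro x
    obtain ⟨i, hi⟩ := (TopologicalSpace.denseRange_denseSeq X).exists_dist_lt x (half_pos hη)
    exact mem_iUnion.2 ⟨i, Metric.mem_ball.2 (hi.trans (hρ i).1)⟩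
  · refine disjointedRec (p := fun s => μ (frontier s) = 0) (fun t j ht => ?_) (hf i)
    have h1 : frontier (t \ B j) ⊆ frontier t ∪ frontier (B j) := by
      rw [sdiff_eq]
      refine (frontier_inter_subset _ _).trans ?_
      rw [frontier_compl]
      exact union_subset_union inter_subset_left inter_subset_right
    exact measure_mono_null h1 (measure_union_null ht (hf j))
  · intro i x hx y hy
    have hx' := Metric.mem_ball.1 (disjointed_subset B i hx)
    have hy' := Metric.mem_ball.1 (disjointed_subset B i hy)
    rw [edist_dist]
    refine ENNReal.ofReal_le_ofReal ?_
    have := dist_triangle_right x y (TopologicalSpace.denseSeq X i)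
    have := (hρ i).2
    linarith

end WC

/-- On a complete separable metric space, if `μ_n → μ` weakly, `1 ≤ q < r`,
`μ` has a finite `r`-th moment about `x₀` and the `r`-th moments of the `μ_n` about `x₀` are
uniformly bounded, then `𝒲_q(μ_n, μ) → 0`. -/
theorem wasserstein_convergence_of_weak_and_moments {𝒳 : Type*} [MetricSpace 𝒳]
    [CompleteSpace 𝒳] [TopologicalSpace.SeparableSpace 𝒳]
    [MeasurableSpace 𝒳] [BorelSpace 𝒳] (x₀ : 𝒳)
    (q r : ℝ) (hq : 1 ≤ q) (hqr : q < r)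
    (μs : ℕ → Measure 𝒳) (μ : Measure 𝒳)
    [∀ n, IsProbabilityMeasure (μs n)] [IsProbabilityMeasure μ]
    (hweak : ∀ f : BoundedContinuousFunction 𝒳 ℝ,
      Tendsto (fun n => ∫ x, f x ∂(μs n)) atTop (nhds (∫ x, f x ∂μ)))
    (hmom : ∫⁻ x, ENNReal.ofReal (dist x x₀ ^ r) ∂μ < ⊤)
    (hmoms : ∃ C : ℝ≥0∞, C < ⊤ ∧ ∀ n, ∫⁻ x, ENNReal.ofReal (dist x x₀ ^ r) ∂(μs n) ≤ C) :
    Tendsto (fun n => wassersteinDist q (μs n) μ) atTop (nhds 0) := by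
  have hq0 : 0 < q := by linarith
  have hr0 : 0 < r := by linarith
  have e : ∀ x : 𝒳, ENNReal.ofReal (dist x x₀ ^ r) = edist x x₀ ^ r := fun x => by
    rw [edist_dist, ENNReal.ofReal_rpow_of_nonneg dist_nonneg hr0.le]
  simp_rw [e] at hmom hmoms
  obtain ⟨C₁, hC₁, hC₁'⟩ := hmoms
  set C := max C₁ (∫⁻ x, edist x x₀ ^ r ∂μ) with hC
  have hCt : C ≠ ⊤ := (max_lt hC₁ hmom).ne
  have hs : 0 < 1 - q / r := by
    rw [sub_pos, div_lt_one hr0]; exact hqr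
  -- weak convergence
  let P : ProbabilityMeasure 𝒳 := ⟨μ, inferInstance⟩
  let Ps : ℕ → ProbabilityMeasure 𝒳 := fun n => ⟨μs n, inferInstance⟩
  have hP : Tendsto Ps atTop (nhds P) :=
    ProbabilityMeasure.tendsto_iff_forall_integral_tendsto.2 hweak
  -- bound function
  let g : ℝ → ℝ≥0∞ := fun η => (ENNReal.ofReal (2 * η) ^ q +
    2 ^ (q - 1) * (2 * (C ^ (q / r) * ENNReal.ofReal η ^ (1 - q / r)))) ^ (1 / q)
  have hg : Tendsto g (nhdsWithin 0 (Set.Ioi 0)) (nhds 0) := by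
    have h1 : Tendsto (fun η : ℝ => ENNReal.ofReal (2 * η) ^ q) (nhds 0) (nhds 0) := by
      have : Continuous (fun η : ℝ => ENNReal.ofReal (2 * η) ^ q) :=
        ENNReal.continuous_rpow_const.comp (ENNReal.continuous_ofReal.comp (by fun_prop))
      simpa [hq0] using this.tendsto 0
    have h2 : Tendsto (fun η : ℝ => ENNReal.ofReal η ^ (1 - q / r)) (nhds 0) (nhds 0) := by
      have : Continuous (fun η : ℝ => ENNReal.ofReal η ^ (1 - q / r)) :=
        ENNReal.continuous_rpow_const.comp ENNReal.continuous_ofReal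
      have h := this.tendsto 0
      rwa [ENNReal.ofReal_zero, ENNReal.zero_rpow_of_pos hs] at h
    have h3 := ENNReal.Tendsto.const_mul (a := 2 ^ (q - 1)) (ENNReal.Tendsto.const_mul (a := 2)
      (ENNReal.Tendsto.const_mul (a := C ^ (q / r)) h2
        (Or.inr (ENNReal.rpow_ne_top_of_nonneg (by positivity) hCt)))
        (Or.inr ENNReal.ofNat_ne_top))
        (Or.inr (ENNReal.rpow_ne_top_of_nonneg (by linarith) ENNReal.ofNat_ne_top))
    have h4 := ((h1.add h3).ennrpow_const (1 / q)).mono_left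
      (nhdsWithin_le_nhds (s := Set.Ioi (0 : ℝ)))
    simpa [g, hq0] using h4
  rw [ENNReal.tendsto_nhds_zero]
  intro ε hε
  obtain ⟨η, hηε, hη⟩ := ((hg.eventually (gt_mem_nhds hε)).and self_mem_nhdsWithin).exists
  have hη : 0 < η := hη
  obtain ⟨A, hA, hd, hU, hfr, hdiam⟩ := WC.partition x₀ μ η hη
  have hη' : (0 : ℝ≥0∞) < ENNReal.ofReal η := ENNReal.ofReal_pos.2 hη
  have h1 : Tendsto (fun N => ENNReal.ofReal η + ∑ i ∈ Finset.range N, μ (A i)) atTop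
      (nhds (ENNReal.ofReal η + 1)) := by
    have := ENNReal.tendsto_nat_tsum (fun i => μ (A i))
    rw [← measure_iUnion hd hA, hU, measure_univ] at this
    exact this.const_add _
  have hlt : (1 : ℝ≥0∞) < ENNReal.ofReal η + 1 := by
    rw [add_comm]; exact ENNReal.lt_add_right ENNReal.one_ne_top hη'.ne'
  obtain ⟨N, hN⟩ := (h1.eventually (lt_mem_nhds hlt)).exists
  have h2 : Tendsto (fun n => ENNReal.ofReal η + ∑ i ∈ Finset.range N, min (μs n (A i)) (μ (A i)))
      atTop (nhds (ENNReal.ofReal η + ∑ i ∈ Finset.range N, μ (A i))) := by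
    refine Tendsto.const_add _ (tendsto_finsetSum _ fun i _ => ?_)
    have h : Tendsto (fun n => μs n (A i)) atTop (nhds (μ (A i))) :=
      ProbabilityMeasure.tendsto_measure_of_null_frontier_of_tendsto' hP (hfr i)
    simpa using h.min (tendsto_const_nhds (x := μ (A i)))
  filter_upwards [h2.eventually (lt_mem_nhds hN)] with n hn
  exact (WC.main_bound x₀ q r hq hqr (μs n) μ A hA hd N _ C _ hdiam
    ((hC₁' n).trans (le_max_left _ _)) (le_max_right _ _) hn.le).trans hηε.le
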